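/- Let (E, {f_i}_{i=1}^m) ∈ 𝓔 with convex hull I. If f_1(I) ∩ f_2(I) = ∅ and f_{m−1}(I) ∩ f_m(I) = ∅, then U_{ℵ₀}(E) = ∅, i.e., no point of E has exactly countably infinitely many codings. -/

import Mathlib

open Set Filter MeasureTheory

/-- A self-similar iterated function system on `ℝ` given by `m` similitudes
`f i x = r i * x + t i` (for `1 ≤ i ≤ m`, `m ≥ 3`), together with its attractor `E`:
the unique nonempty compact set with `E = ⋃_{i=1}^m f_i(E)`. -/
structure ClassE where
  m : ℕ
  r : ℕ → ℝ
  t : ℕ → ℝ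
  E : Set ℝ
  hm : 3 ≤ m
  hr : ∀ i, 1 ≤ i → i ≤ m → 0 < r i ∧ r i < 1
  hEne : E.Nonempty
  hEcpt : IsCompact E
  hEinv : E = ⋃ i ∈ Finset.Icc 1 m, (fun x => r i * x + t i) '' E

namespace ClassE

/-- The `i`-th similitude. -/
def f (S : ClassE) (i : ℕ) (x : ℝ) : ℝ := S.r i * x + S.t i

/-- Left endpoint `a` of the convex hull of `E`. -/
noncomputable def a (S : ClassE) : ℝ := sInf S.E

/-- Right endpoint `b` of the convex hull of `E`. -/
noncomputable def b (S : ClassE) : ℝ := sSup S.E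

/-- The convex hull `I = [a, b]` of `E`. -/
noncomputable def I (S : ClassE) : Set ℝ := Set.Icc S.a S.b

/-- Condition (A): `a = f_1(a) < f_2(a) < ⋯ < f_m(a) < f_m(b) = b`. -/
def condA (S : ClassE) : Prop :=
  S.f 1 S.a = S.a ∧ (∀ i, 1 ≤ i → i < S.m → S.f i S.a < S.f (i + 1) S.a) ∧
    S.f S.m S.a < S.f S.m S.b ∧ S.f S.m S.b = S.b

/-- Condition (B): `f_i(I) ∩ f_{i+2}(I) = ∅` for all `1 ≤ i ≤ m - 2`. -/
def condB (S : ClassE) : Prop :=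
  ∀ i, 1 ≤ i → i + 2 ≤ S.m → S.f i '' S.I ∩ S.f (i + 2) '' S.I = ∅

/-- Condition (C): there are `i, j ∈ {1, …, m-1}` with `f_i(I) ∩ f_{i+1}(I) = ∅` and
`f_j(I) ∩ f_{j+1}(I) ≠ ∅`. -/
def condC (S : ClassE) : Prop :=
  (∃ i, 1 ≤ i ∧ i + 1 ≤ S.m ∧ S.f i '' S.I ∩ S.f (i + 1) '' S.I = ∅) ∧
    (∃ j, 1 ≤ j ∧ j + 1 ≤ S.m ∧ S.f j '' S.I ∩ S.f (j + 1) '' S.I ≠ ∅)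

/-- Condition (D): whenever `f_i(I) ∩ f_{i+1}(I) ≠ ∅` there are `u, v ≥ 1` with
`f_i(I) ∩ f_{i+1}(I) = f_i ∘ f_m^u (I) = f_{i+1} ∘ f_1^v (I)`. -/
def condD (S : ClassE) : Prop :=
  ∀ i, 1 ≤ i → i + 1 ≤ S.m → S.f i '' S.I ∩ S.f (i + 1) '' S.I ≠ ∅ →
    ∃ u v : ℕ, 1 ≤ u ∧ 1 ≤ v ∧
      S.f i '' S.I ∩ S.f (i + 1) '' S.I = (S.f i ∘ (S.f S.m)^[u]) '' S.I ∧
      S.f i '' S.I ∩ S.f (i + 1) '' S.I = (S.f (i + 1) ∘ (S.f 1)^[v]) '' S.I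

/-- Membership in the class `𝓔`: conditions (A)–(D). -/
def goodE (S : ClassE) : Prop := S.condA ∧ S.condB ∧ S.condC ∧ S.condD

/-- `prefixMap d n = f_{d 0} ∘ f_{d 1} ∘ ⋯ ∘ f_{d (n-1)}`. -/
def prefixMap (S : ClassE) (d : ℕ → ℕ) : ℕ → ℝ → ℝ
  | 0 => id
  | n + 1 => S.prefixMap d n ∘ S.f (d n)

/-- `d : ℕ → ℕ` (with digits in `{1, …, m}`) is a coding of `x` if
`x = lim_n f_{d 0} ∘ ⋯ ∘ f_{d (n-1)} (0)`. -/
def isCoding (S : ClassE) (d : ℕ → ℕ) (x : ℝ) : Prop :=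
  (∀ n, 1 ≤ d n ∧ d n ≤ S.m) ∧
    Tendsto (fun n => S.prefixMap d n 0) atTop (nhds x)

/-- The set of codings of `x`. -/
def codings (S : ClassE) (x : ℝ) : Set (ℕ → ℕ) := {d | S.isCoding d x}

/-- `U k E`: the set of points of `E` having exactly `k` distinct codings
(`k` a cardinal; e.g. `k = ℵ₀` for countably infinitely many codings,
`k = 𝔠 = 2^ℵ₀` for a continuum of codings). -/
def U (S : ClassE) (k : Cardinal) : Set ℝ :=
  {x ∈ S.E | Cardinal.mk (S.codings x) = k}

end ClassE

open ClassE

namespace ClassE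

def pcons (i : ℕ) (d : ℕ → ℕ) : ℕ → ℕ
  | 0 => i
  | n + 1 => d n

def pshift (d : ℕ → ℕ) : ℕ → ℕ := fun n => d (n + 1)

lemma pcons_pshift (d : ℕ → ℕ) : pcons (d 0) (pshift d) = d := by
  funext n; cases n <;> rfl

lemma pshift_pcons (i : ℕ) (d : ℕ → ℕ) : pshift (pcons i d) = d := rfl

lemma pcons_inj (i : ℕ) : Function.Injective (pcons i) := by
  intro d e h
  have := congrArg pshift h
  exact this

lemma prefixMap_succ' (S : ClassE) (d : ℕ → ℕ) (n : ℕ) :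
    S.prefixMap d (n + 1) = S.f (d 0) ∘ S.prefixMap (pshift d) n := by
  induction n with
  | zero => rfl
  | succ n ih =>
    have : S.prefixMap d (n + 1 + 1) = S.prefixMap d (n + 1) ∘ S.f (d (n + 1)) := rfl
    rw [this, ih]; rfl

lemma prefixMap_congr (S : ClassE) (d e : ℕ → ℕ) (n : ℕ) (h : ∀ k < n, d k = e k) :
    S.prefixMap d n = S.prefixMap e n := by
  induction n with
  | zero => rfl
  | succ n ih =>
    change S.prefixMap d n ∘ S.f (d n) = S.prefixMap e n ∘ S.f (e n)
    rw [ih (fun k hk => h k (by omega)), h n (by omega)]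

lemma f_cont (S : ClassE) (i : ℕ) : Continuous (S.f i) := by
  unfold f; fun_prop

lemma f_strict (S : ClassE) {i : ℕ} (h : 1 ≤ i ∧ i ≤ S.m) : StrictMono (S.f i) := by
  intro x y hxy
  have := mul_lt_mul_of_pos_left hxy (S.hr i h.1 h.2).1
  unfold f; linarith

lemma isCoding_pcons (S : ClassE) {i : ℕ} (h : 1 ≤ i ∧ i ≤ S.m) {d : ℕ → ℕ} {y : ℝ}
    (hd : S.isCoding d y) : S.isCoding (pcons i d) (S.f i y) := by
  refine ⟨fun n => ?_, ?_⟩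
  · cases n with
    | zero => exact h
    | succ n => exact hd.1 n
  · rw [← tendsto_add_atTop_iff_nat 1]
    simp only [prefixMap_succ']
    exact ((S.f_cont i).tendsto y).comp hd.2

lemma isCoding_pshift (S : ClassE) {d : ℕ → ℕ} {x : ℝ} (hd : S.isCoding d x) :
    ∃ y, x = S.f (d 0) y ∧ S.isCoding (pshift d) y := by
  have hr := (S.hr (d 0) (hd.1 0).1 (hd.1 0).2).1
  refine ⟨(x - S.t (d 0)) / S.r (d 0), ?_, fun n => hd.1 (n + 1), ?_⟩
  · unfold f; field_simp; ring
  · have h := hd.2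
    rw [← tendsto_add_atTop_iff_nat 1] at h
    simp only [prefixMap_succ'] at h
    have h2 := (h.sub_const (S.t (d 0))).div_const (S.r (d 0))
    refine h2.congr (fun n => ?_)
    simp only [Function.comp, f]
    field_simp; ring

lemma exists_rho (S : ClassE) : ∃ ρ : ℝ, 0 ≤ ρ ∧ ρ < 1 ∧ ∀ i, 1 ≤ i → i ≤ S.m → S.r i ≤ ρ := by
  have hm := S.hm
  obtain ⟨i, hi, hmax⟩ := Finset.exists_max_image (Finset.Icc 1 S.m) S.r
    ⟨1, by simp; omega⟩
  rw [Finset.mem_Icc] at hi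
  refine ⟨S.r i, (S.hr i hi.1 hi.2).1.le, (S.hr i hi.1 hi.2).2, fun j h1 h2 => hmax j ?_⟩
  simp [h1, h2]

lemma prefix_dist (S : ClassE) {ρ : ℝ} (h0 : 0 ≤ ρ)
    (hρ : ∀ i, 1 ≤ i → i ≤ S.m → S.r i ≤ ρ) (d : ℕ → ℕ)
    (hd : ∀ n, 1 ≤ d n ∧ d n ≤ S.m) (n : ℕ) (x y : ℝ) :
    |S.prefixMap d n x - S.prefixMap d n y| ≤ ρ ^ n * |x - y| := by
  induction n generalizing x y with
  | zero => simp [prefixMap]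
  | succ n ih =>
    have hp := (S.hr (d n) (hd n).1 (hd n).2).1
    calc |S.prefixMap d (n+1) x - S.prefixMap d (n+1) y|
        ≤ ρ ^ n * |S.f (d n) x - S.f (d n) y| := ih _ _
      _ = ρ ^ n * (S.r (d n) * |x - y|) := by
          congr 1
          rw [← abs_of_pos hp, ← abs_mul]
          unfold f; congr 1; ring
      _ ≤ ρ ^ n * (ρ * |x - y|) := by
          gcongr
          exact hρ _ (hd n).1 (hd n).2
      _ = ρ ^ (n+1) * |x - y| := by ring

lemma tendsto_diff (S : ClassE) (d : ℕ → ℕ) (hd : ∀ n, 1 ≤ d n ∧ d n ≤ S.m) (s : Set ℝ)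
    (hs : Bornology.IsBounded s) (x : ℕ → ℝ) (hx : ∀ n, x n ∈ s) :
    Tendsto (fun n => S.prefixMap d n 0 - S.prefixMap d n (x n)) atTop (nhds 0) := by
  obtain ⟨ρ, h0, h1, hρ⟩ := S.exists_rho
  obtain ⟨C, hC⟩ := hs.exists_norm_le
  apply squeeze_zero_norm (a := fun n => ρ ^ n * C)
  · intro n
    rw [Real.norm_eq_abs]
    refine (S.prefix_dist h0 hρ d hd n _ _).trans ?_
    have := hC _ (hx n)
    rw [Real.norm_eq_abs] at this
    rw [zero_sub, abs_neg]
    gcongr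
  · simpa using (tendsto_pow_atTop_nhds_zero_of_lt_one h0 h1).mul_const C

lemma f_mem_E (S : ClassE) {i : ℕ} (h : 1 ≤ i ∧ i ≤ S.m) {x : ℝ} (hx : x ∈ S.E) :
    S.f i x ∈ S.E := by
  rw [S.hEinv]
  simp only [mem_iUnion]
  exact ⟨i, by simp [h], x, hx, rfl⟩

lemma a_mem (S : ClassE) : S.a ∈ S.E := S.hEcpt.sInf_mem S.hEne
lemma b_mem (S : ClassE) : S.b ∈ S.E := S.hEcpt.sSup_mem S.hEne
lemma E_sub (S : ClassE) {x : ℝ} (hx : x ∈ S.E) : x ∈ S.I :=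
  ⟨csInf_le S.hEcpt.bddBelow hx, le_csSup S.hEcpt.bddAbove hx⟩

lemma f_mem_I (S : ClassE) {i : ℕ} (h : 1 ≤ i ∧ i ≤ S.m) {x : ℝ} (hx : x ∈ S.I) :
    S.f i x ∈ S.I := by
  have ha := (S.E_sub (S.f_mem_E h S.a_mem)).1
  have hb := (S.E_sub (S.f_mem_E h S.b_mem)).2
  exact ⟨ha.trans ((S.f_strict h).monotone hx.1), ((S.f_strict h).monotone hx.2).trans hb⟩

lemma coding_mem_I (S : ClassE) {d : ℕ → ℕ} {x : ℝ} (hd : S.isCoding d x) : x ∈ S.I := by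
  have h := S.tendsto_diff d hd.1 S.I (Metric.isBounded_Icc _ _) (fun _ => S.a)
    (fun _ => S.E_sub S.a_mem)
  have h2 := hd.2.sub h
  simp only [sub_sub_cancel, sub_zero] at h2
  refine isClosed_Icc.mem_of_tendsto h2 (Eventually.of_forall fun n => ?_)
  have : ∀ n, ∀ y ∈ S.I, S.prefixMap d n y ∈ S.I := by
    intro n
    induction n with
    | zero => exact fun y hy => hy
    | succ n ih => exact fun y hy => ih _ (S.f_mem_I (hd.1 n) hy)
  exact this n _ (S.E_sub S.a_mem)

lemma coding_iff (S : ClassE) (d : ℕ → ℕ) (x : ℝ) : S.isCoding d x ↔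
    ∀ n, (1 ≤ d n ∧ d n ≤ S.m) ∧ x ∈ S.prefixMap d n '' S.I := by
  constructor
  · intro hd n
    refine ⟨hd.1 n, ?_⟩
    induction n generalizing d x with
    | zero => exact ⟨x, S.coding_mem_I hd, rfl⟩
    | succ n ih =>
      obtain ⟨y, rfl, hy⟩ := S.isCoding_pshift hd
      obtain ⟨z, hz, h⟩ := ih _ _ hy
      exact ⟨z, hz, by rw [prefixMap_succ', ← h]; rfl⟩
  · intro h
    choose h1 z hz hx using h
    refine ⟨h1, ?_⟩
    have := S.tendsto_diff d h1 S.I (Metric.isBounded_Icc _ _) z hz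
    simp only [hx] at this
    simpa using this.add_const x

lemma isClosed_codings (S : ClassE) (x : ℝ) : IsClosed (S.codings x) := by
  rw [← isOpen_compl_iff, isOpen_iff_mem_nhds]
  intro d hd
  have hd' : ¬ S.isCoding d x := hd
  rw [coding_iff] at hd'
  push Not at hd'
  obtain ⟨n, hn⟩ := hd'
  refine Filter.mem_of_superset
    ((PiNat.isOpen_cylinder (fun _ => ℕ) d (n+1)).mem_nhds (PiNat.self_mem_cylinder d (n+1))) ?_
  intro e he hc
  have hc' : S.isCoding e x := hc
  rw [coding_iff] at hc'
  have he' : ∀ k < n + 1, e k = d k := he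
  obtain ⟨h1, h2⟩ := hc' n
  rw [he' n (by omega)] at h1
  rw [S.prefixMap_congr e d n (fun k hk => he' k (by omega))] at h2
  exact hn h1 h2

/-! ### Overlap structure -/

lemma fa_lt (S : ClassE) (hA : S.condA) {i j : ℕ} (hi : 1 ≤ i) (hij : i < j) (hj : j ≤ S.m) :
    S.f i S.a < S.f j S.a := by
  induction j, hij using Nat.le_induction with
  | base => exact hA.2.1 i hi (by omega)
  | succ k hk ih => exact (ih (by omega)).trans (hA.2.1 k (by omega) (by omega))

lemma digits_close (S : ClassE) (hS : S.goodE) {i j : ℕ} (hi : 1 ≤ i) (hj : j ≤ S.m) {x : ℝ}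
    (hxi : x ∈ S.f i '' S.I) (hxj : x ∈ S.f j '' S.I) : j ≤ i + 1 := by
  by_contra hcon
  push Not at hcon
  have hA := hS.1
  obtain ⟨y, hy, rfl⟩ := hxi
  obtain ⟨z, hz, hzy⟩ := hxj
  have hab : S.a ≤ S.b := hy.1.trans hy.2
  have ii : 1 ≤ i ∧ i ≤ S.m := ⟨hi, by omega⟩
  have i2 : 1 ≤ i + 2 ∧ i + 2 ≤ S.m := ⟨by omega, by omega⟩
  have jj : 1 ≤ j ∧ j ≤ S.m := ⟨by omega, by omega⟩
  have h1 : S.f i S.a < S.f (i+2) S.a := S.fa_lt hA hi (by omega) i2.2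
  have h2 : S.f (i+2) S.a ≤ S.f j S.a := by
    rcases Nat.lt_or_ge (i+2) j with h | h
    · exact (S.fa_lt hA (by omega) h hj).le
    · have : i + 2 = j := by omega
      rw [this]
  have h3 : S.f j S.a ≤ S.f j z := (S.f_strict jj).monotone hz.1
  have hy2 : S.f i y ≤ S.f i S.b := (S.f_strict ii).monotone hy.2
  have hB := hS.2.1 i hi i2.2
  have hmem : S.f (i+2) S.a ∈ S.f i '' S.I := by
    have := intermediate_value_Icc hab (S.f_cont i).continuousOn
    exact this ⟨h1.le, by linarith⟩
  have : S.f (i+2) S.a ∈ S.f i '' S.I ∩ S.f (i + 2) '' S.I :=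
    ⟨hmem, S.a, ⟨le_rfl, hab⟩, rfl⟩
  rw [hB] at this
  exact this

lemma iter_affine (S : ClassE) {i : ℕ} (h : 1 ≤ i ∧ i ≤ S.m) (n : ℕ) :
    ∃ A B : ℝ, 0 < A ∧ ∀ x, (S.f i)^[n] x = A * x + B := by
  induction n with
  | zero => exact ⟨1, 0, one_pos, fun x => by simp⟩
  | succ n ih =>
    obtain ⟨A, B, hA, hx⟩ := ih
    refine ⟨S.r i * A, S.r i * B + S.t i, mul_pos (S.hr i h.1 h.2).1 hA, fun x => ?_⟩
    rw [Function.iterate_succ_apply', hx]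
    unfold f; ring

lemma affine_eq {A B A' B' a b : ℝ} (hab : a < b) (hA : 0 < A) (hA' : 0 < A')
    (h : (fun x => A * x + B) '' Icc a b = (fun x => A' * x + B') '' Icc a b) :
    A = A' ∧ B = B' := by
  have key : ∀ {A B A' B' : ℝ}, 0 < A → 0 < A' →
      (fun x => A * x + B) '' Icc a b = (fun x => A' * x + B') '' Icc a b →
      A' * a + B' ≤ A * a + B ∧ A * b + B ≤ A' * b + B' := by
    intro A B A' B' hA hA' h
    have h1 : A * a + B ∈ (fun x => A' * x + B') '' Icc a b := by
      rw [← h]; exact ⟨a, ⟨le_rfl, hab.le⟩, rfl⟩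
    have h2 : A * b + B ∈ (fun x => A' * x + B') '' Icc a b := by
      rw [← h]; exact ⟨b, ⟨hab.le, le_rfl⟩, rfl⟩
    obtain ⟨y, hy, e1⟩ := h1
    obtain ⟨z, hz, e2⟩ := h2
    simp only at e1 e2
    have := mul_le_mul_of_nonneg_left hy.1 hA'.le
    have := mul_le_mul_of_nonneg_left hz.2 hA'.le
    constructor <;> linarith
  obtain ⟨p1, p2⟩ := key hA hA' h
  obtain ⟨q1, q2⟩ := key hA' hA h.symm
  have e : (A - A') * (b - a) = 0 := by nlinarith
  have : A = A' := by
    rcases mul_eq_zero.1 e with h | h <;> linarith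
  subst this
  exact ⟨rfl, by linarith⟩

lemma D_maps_eq (S : ClassE) (hab : S.a < S.b) {i j k l u v : ℕ} (hi : 1 ≤ i ∧ i ≤ S.m)
    (hj : 1 ≤ j ∧ j ≤ S.m) (hk : 1 ≤ k ∧ k ≤ S.m) (hl : 1 ≤ l ∧ l ≤ S.m)
    (h : (S.f i ∘ (S.f k)^[u]) '' S.I = (S.f j ∘ (S.f l)^[v]) '' S.I) (z : ℝ) :
    S.f i ((S.f k)^[u] z) = S.f j ((S.f l)^[v] z) := by
  obtain ⟨A, B, hA, hx⟩ := S.iter_affine hk u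
  obtain ⟨A', B', hA', hx'⟩ := S.iter_affine hl v
  have e1 : S.f i ∘ (S.f k)^[u] = fun x => (S.r i * A) * x + (S.r i * B + S.t i) := by
    funext x; simp only [Function.comp, hx, f]; ring
  have e2 : S.f j ∘ (S.f l)^[v] = fun x => (S.r j * A') * x + (S.r j * B' + S.t j) := by
    funext x; simp only [Function.comp, hx', f]; ring
  have h' := h
  rw [e1, e2] at h'
  obtain ⟨p, q⟩ := affine_eq hab (mul_pos (S.hr i hi.1 hi.2).1 hA)
    (mul_pos (S.hr j hj.1 hj.2).1 hA') h'
  have : S.f i ∘ (S.f k)^[u] = S.f j ∘ (S.f l)^[v] := by rw [e1, e2, p, q]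
  exact congrFun this z

lemma codings_first (S : ClassE) {d : ℕ → ℕ} {i : ℕ} {y : ℝ} (hd : d ∈ S.codings (S.f i y))
    (h0 : d 0 = i) : d ∈ pcons i '' S.codings y := by
  have hd' : S.isCoding d (S.f i y) := hd
  obtain ⟨y', e, h⟩ := S.isCoding_pshift hd'
  have hi := hd'.1 0
  rw [h0] at e hi
  have := (S.f_strict hi).injective e
  subst this
  exact ⟨pshift d, h, by rw [← h0]; exact pcons_pshift d⟩

lemma mem_first (S : ClassE) {d : ℕ → ℕ} {x : ℝ} (hd : S.isCoding d x) :
    x ∈ S.f (d 0) '' S.I := by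
  obtain ⟨y, e, h⟩ := S.isCoding_pshift hd
  exact ⟨y, S.coding_mem_I h, e.symm⟩

/-- A digit whose cylinder is isolated from all others. -/
def Iso (S : ClassE) (w : ℕ) : Prop := (1 ≤ w ∧ w ≤ S.m) ∧
  ∀ k, 1 ≤ k → k ≤ S.m → ∀ x, x ∈ S.f w '' S.I → x ∈ S.f k '' S.I → k = w

lemma codings_iter (S : ClassE) {w : ℕ} (hw : S.Iso w) (n : ℕ) {z : ℝ} (hz : z ∈ S.I) :
    (S.f w)^[n] z ∈ S.I ∧ S.codings ((S.f w)^[n] z) = (pcons w)^[n] '' S.codings z := by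
  induction n with
  | zero => exact ⟨hz, by simp⟩
  | succ n ih =>
    obtain ⟨h1, h2⟩ := ih
    rw [Function.iterate_succ_apply', Function.iterate_succ', image_comp, ← h2]
    refine ⟨S.f_mem_I hw.1 h1, ?_⟩
    apply Subset.antisymm
    · intro d hd
      have hd' : S.isCoding d _ := hd
      exact S.codings_first hd (hw.2 _ (hd'.1 0).1 (hd'.1 0).2 _ ⟨_, h1, rfl⟩ (S.mem_first hd'))
    · rintro _ ⟨d, hd, rfl⟩
      exact S.isCoding_pcons hw.1 hd

lemma iso_one (S : ClassE) (hS : S.goodE) (h1 : S.f 1 '' S.I ∩ S.f 2 '' S.I = ∅) : S.Iso 1 := by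
  have hm := S.hm
  refine ⟨⟨le_rfl, by omega⟩, fun k hk hkm x hx hxk => ?_⟩
  have := S.digits_close hS le_rfl hkm hx hxk
  by_contra hne
  have : k = 2 := by omega
  subst this
  have : x ∈ S.f 1 '' S.I ∩ S.f 2 '' S.I := ⟨hx, hxk⟩
  rw [h1] at this; exact this

lemma iso_m (S : ClassE) (hS : S.goodE)
    (h2 : S.f (S.m - 1) '' S.I ∩ S.f S.m '' S.I = ∅) : S.Iso S.m := by
  have hm := S.hm
  refine ⟨⟨by omega, le_rfl⟩, fun k hk hkm x hx hxk => ?_⟩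
  have := S.digits_close hS hk le_rfl hxk hx
  by_contra hne
  have : k = S.m - 1 := by omega
  subst this
  have : x ∈ S.f (S.m - 1) '' S.I ∩ S.f S.m '' S.I := ⟨hxk, hx⟩
  rw [h2] at this; exact this

/-- At a branching point, everything is controlled by a single point `z`. -/
lemma branch_finite (S : ClassE) (hS : S.goodE) (i1 : S.Iso 1) (im : S.Iso S.m)
    {p : ℕ} (hp : 1 ≤ p) (hpm : p + 1 ≤ S.m) {x : ℝ}
    (hx : x ∈ S.f p '' S.I) (hx' : x ∈ S.f (p+1) '' S.I) {q : ℕ} (hq : q = p ∨ q = p + 1) {y : ℝ}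
    (hy : x = S.f q y) (hfin : (S.codings y).Finite) : (S.codings x).Finite := by
  have hA := hS.1
  have hab : S.a < S.b := (S.f_strict im.1).lt_iff_lt.1 hA.2.2.1
  have hxx : x ∈ S.f p '' S.I ∩ S.f (p+1) '' S.I := ⟨hx, hx'⟩
  obtain ⟨u, v, -, -, hu, hv⟩ := hS.2.2.2 p hp hpm (by rw [← nonempty_iff_ne_empty]; exact ⟨x, hxx⟩)
  have pp : 1 ≤ p ∧ p ≤ S.m := ⟨hp, by omega⟩
  have pp' : 1 ≤ p + 1 ∧ p + 1 ≤ S.m := ⟨by omega, hpm⟩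
  have hmaps := S.D_maps_eq hab pp pp' im.1 i1.1 (hu.symm.trans hv)
  rw [hu] at hxx
  obtain ⟨z, hz, hzx⟩ := hxx
  have ex : x = S.f p ((S.f S.m)^[u] z) := hzx.symm
  have ex' : x = S.f (p+1) ((S.f 1)^[v] z) := ex.trans (hmaps z)
  obtain ⟨-, cu⟩ := S.codings_iter im u hz
  obtain ⟨-, cv⟩ := S.codings_iter i1 v hz
  have hzfin : (S.codings z).Finite := by
    rcases hq with rfl | rfl
    · have := (S.f_strict pp).injective (hy.symm.trans ex)
      rw [this, cu] at hfin
      exact hfin.of_finite_image (((pcons_inj S.m).iterate u).injOn)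
    · have := (S.f_strict pp').injective (hy.symm.trans ex')
      rw [this, cv] at hfin
      exact hfin.of_finite_image (((pcons_inj 1).iterate v).injOn)
  have f1 : (pcons p '' S.codings ((S.f S.m)^[u] z)).Finite := by
    rw [cu]; exact (hzfin.image _).image _
  have f2 : (pcons (p+1) '' S.codings ((S.f 1)^[v] z)).Finite := by
    rw [cv]; exact (hzfin.image _).image _
  refine (f1.union f2).subset ?_
  intro d hd
  have hd' : S.isCoding d x := hd
  have hm := S.mem_first hd'
  have c1 := S.digits_close hS hp (hd'.1 0).2 hx hm
  have c2 := S.digits_close hS (hd'.1 0).1 hpm hm hx'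
  have : d 0 = p ∨ d 0 = p + 1 := by omega
  rcases this with h | h
  · left
    rw [ex] at hd
    exact S.codings_first hd h
  · right
    rw [ex'] at hd
    exact S.codings_first hd h

lemma step_finite (S : ClassE) (hS : S.goodE) (i1 : S.Iso 1) (im : S.Iso S.m)
    {d : ℕ → ℕ} {x y : ℝ} (hd : S.isCoding d x) (hy : x = S.f (d 0) y)
    (hfin : (S.codings y).Finite) : (S.codings x).Finite := by
  by_cases hall : ∀ e ∈ S.codings x, e 0 = d 0
  · refine (hfin.image (pcons (d 0))).subset fun e he => ?_
    have h0 := hall e he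
    rw [hy] at he
    exact S.codings_first he h0
  · push Not at hall
    obtain ⟨e, he, hne⟩ := hall
    have he' : S.isCoding e x := he
    have m1 := S.mem_first hd
    have m2 := S.mem_first he'
    have b1 := hd.1 0
    have b2 := he'.1 0
    have c1 := S.digits_close hS b1.1 b2.2 m1 m2
    have c2 := S.digits_close hS b2.1 b1.2 m2 m1
    have : e 0 = d 0 + 1 ∨ d 0 = e 0 + 1 := by omega
    rcases this with h | h
    · rw [h] at m2 b2
      exact S.branch_finite hS i1 im b1.1 b2.2 m1 m2 (Or.inl rfl) hy hfin
    · rw [h] at m1 b1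
      exact S.branch_finite hS i1 im b2.1 b1.2 m2 m1 (Or.inr h) hy hfin

lemma isolated_finite (S : ClassE) (hS : S.goodE) (i1 : S.Iso 1) (im : S.Iso S.m) (n : ℕ) :
    ∀ (d : ℕ → ℕ) (x : ℝ), S.isCoding d x →
      (∀ e, S.isCoding e x → (∀ k < n, e k = d k) → e = d) → (S.codings x).Finite := by
  induction n with
  | zero =>
    intro d x hd h
    exact (finite_singleton d).subset fun e he => h e he (by simp)
  | succ n ih =>
    intro d x hd h
    obtain ⟨y, hy, hc⟩ := S.isCoding_pshift hd
    refine S.step_finite hS i1 im hd hy (ih _ y hc ?_)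
    intro e he hk
    have h1 := S.isCoding_pcons (hd.1 0) he
    rw [← hy] at h1
    have := h _ h1 (fun k hk' => by
      cases k with
      | zero => rfl
      | succ k => exact hk k (by omega))
    rw [← this]; rfl

lemma perfect_codings (S : ClassE) (hS : S.goodE) (i1 : S.Iso 1) (im : S.Iso S.m) {x : ℝ}
    (hinf : (S.codings x).Infinite) : Perfect (S.codings x) := by
  refine ⟨S.isClosed_codings x, fun d hd => ?_⟩
  rw [accPt_iff_nhds]
  intro U hU
  by_contra hcon
  push Not at hcon
  obtain ⟨V, ⟨c, n, rfl⟩, hdV, hVU⟩ := (PiNat.isTopologicalBasis_cylinders (fun _ => ℕ)).mem_nhds_iff.1 hU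
  refine hinf (S.isolated_finite hS i1 im n d x hd fun e he hk => hcon e ⟨hVU ?_, he⟩)
  intro k hk'
  exact (hk k hk').trans (hdV k hk')

end ClassE

theorem stmt17 (S : ClassE) (hS : S.goodE)
    (h1 : S.f 1 '' S.I ∩ S.f 2 '' S.I = ∅)
    (h2 : S.f (S.m - 1) '' S.I ∩ S.f S.m '' S.I = ∅) :
    S.U Cardinal.aleph0 = ∅ := by
  rw [eq_empty_iff_forall_notMem]
  rintro x ⟨-, hx⟩
  have h4 : Cardinal.mk (ℕ → Bool) = 2 ^ Cardinal.aleph0 := by simp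
  have hinf : (S.codings x).Infinite := by
    rw [← Set.infinite_coe_iff, Cardinal.infinite_iff]; exact hx.ge
  have hcount : (S.codings x).Countable := by
    rw [← Cardinal.le_aleph0_iff_set_countable]; exact hx.le
  have hperf := S.perfect_codings hS (S.iso_one hS h1) (S.iso_m hS h2) hinf
  letI := TopologicalSpace.upgradeIsCompletelyMetrizable (ℕ → ℕ)
  obtain ⟨g, hg, -, hinj⟩ := hperf.exists_nat_bool_injection hinf.nonempty
  have hc : Countable (S.codings x) := hcount
  have hb : Countable (ℕ → Bool) :=
    Function.Injective.countable (f := fun s => (⟨g s, hg ⟨s, rfl⟩⟩ : S.codings x))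
      (fun s t hst => hinj (congrArg Subtype.val hst))
  have h3 : Cardinal.mk (ℕ → Bool) ≤ Cardinal.aleph0 := Cardinal.mk_le_aleph0
  rw [h4] at h3
  exact absurd h3 (not_le.2 (Cardinal.cantor _))
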